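/- arXiv:0709.0712 — 2 statements merged into one kernel-verified Lean document; each statement's English description precedes it below -/
import Mathlib

section
/- If G < GL(V) is a finite abelian group generated by transvections, then every linear form defining the fixed hyperplane of a transvection in G is G-invariant; consequently the annihilator (V^G)^⊥ ⊆ V* of the common fixed space V^G is spanned by G-invariant linear forms. -/
open Module

variable {k V : Type*} [Field k] [AddCommGroup V] [Module k V]

/-- The "moved" subspace `(τ − 1)V` of a linear automorphism. -/
def lmove (τ : V ≃ₗ[k] V) : Submodule k V :=
  LinearMap.range ((τ : V →ₗ[k] V) - LinearMap.id)

/-- The fixed subspace `V^τ = ker (τ − 1)` of a linear automorphism. -/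
def lfix (τ : V ≃ₗ[k] V) : Submodule k V :=
  LinearMap.ker ((τ : V →ₗ[k] V) - LinearMap.id)

/-- A pseudo-reflection: the fixed space has codimension one, i.e. `(τ−1)V` is a line. -/
def IsPseudoReflection (τ : V ≃ₗ[k] V) : Prop :=
  Module.finrank k (lmove τ) = 1

/-- A transvection: a pseudo-reflection with `(τ−1)V ⊆ V^τ`. -/
def IsTransvection (τ : V ≃ₗ[k] V) : Prop :=
  IsPseudoReflection τ ∧ lmove τ ≤ lfix τ

/-- A homology: a pseudo-reflection that is not a transvection (it is then diagonalizable). -/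
def IsHomology (τ : V ≃ₗ[k] V) : Prop :=
  IsPseudoReflection τ ∧ ¬ lmove τ ≤ lfix τ

theorem mem_lfix_iff (τ : V ≃ₗ[k] V) (v : V) : v ∈ lfix τ ↔ τ v = v := by
  simp [lfix, sub_eq_zero]

theorem sub_mem_lmove (τ : V ≃ₗ[k] V) (v : V) : τ v - v ∈ lmove τ :=
  ⟨v, by simp⟩

/-- The moved line of a pseudo-reflection lies in the fixed space of every commuting map `τ`
with `(τ − 1)V ⊆ V^τ`. -/
theorem IsPseudoReflection.lmove_le_lfix_of_commute {σ τ : V ≃ₗ[k] V}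
    (hσ : IsPseudoReflection σ) (hτ : lmove τ ≤ lfix τ) (h : Commute σ τ) :
    lmove σ ≤ lfix τ := by
  rintro _ ⟨v, rfl⟩
  have hcomm : σ (τ v) = τ (σ v) := LinearEquiv.congr_fun h.eq v
  simp only [LinearMap.sub_apply, LinearEquiv.coe_coe, LinearMap.id_apply]
  by_contra hne
  rw [mem_lfix_iff, ← sub_eq_zero] at hne
  have hwσ : τ (σ v - v) - (σ v - v) ∈ lmove σ := by
    have := sub_mem_lmove σ (τ v - v)
    rw [map_sub, hcomm] at this
    rw [map_sub]
    convert this using 1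
    abel
  obtain ⟨c, hc⟩ := (finrank_eq_one_iff_of_nonzero' (⟨_, hwσ⟩ : lmove σ)
    (fun h0 => hne (congrArg Subtype.val h0))).1 hσ ⟨_, sub_mem_lmove σ v⟩
  have hc' : c • (τ (σ v - v) - (σ v - v)) = σ v - v := congrArg Subtype.val hc
  have hfix : σ v - v ∈ lfix τ := by
    rw [← hc']
    exact Submodule.smul_mem _ _ (hτ (sub_mem_lmove τ _))
  exact hne (sub_eq_zero.2 ((mem_lfix_iff τ _).1 hfix))

/-- The fixed space of a pseudo-reflection is the kernel of a linear form. -/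
theorem IsPseudoReflection.exists_ker_eq_lfix {τ : V ≃ₗ[k] V} (hτ : IsPseudoReflection τ) :
    ∃ x : Module.Dual k V, LinearMap.ker x = lfix τ := by
  unfold IsPseudoReflection lmove at hτ
  have : FiniteDimensional k (LinearMap.range ((τ : V →ₗ[k] V) - LinearMap.id)) :=
    Module.finite_of_finrank_eq_succ hτ
  have e : LinearMap.range ((τ : V →ₗ[k] V) - LinearMap.id) ≃ₗ[k] k :=
    LinearEquiv.ofFinrankEq _ _ (by rw [hτ, Module.finrank_self])
  refine ⟨e.toLinearMap ∘ₗ ((τ : V →ₗ[k] V) - LinearMap.id).rangeRestrict, ?_⟩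
  rw [LinearEquiv.ker_comp, LinearMap.ker_rangeRestrict, lfix]

/-- A vector fixed by a generating set of a subgroup is fixed by the subgroup. -/
theorem mem_lfix_of_mem_closure {S : Set (V ≃ₗ[k] V)} {v : V} (h : ∀ τ ∈ S, v ∈ lfix τ)
    {σ : V ≃ₗ[k] V} (hσ : σ ∈ Subgroup.closure S) : v ∈ lfix σ := by
  have hle : Subgroup.closure S ≤ MulAction.stabilizer (V ≃ₗ[k] V) v :=
    (Subgroup.closure_le _).2 fun τ hτ => (mem_lfix_iff τ v).1 (h τ hτ)
  exact (mem_lfix_iff σ v).2 (hle hσ)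

/-- A linear form invariant under a generating set of a subgroup is invariant under the
subgroup. -/
theorem comp_eq_of_mem_closure {S : Set (V ≃ₗ[k] V)} {x : Module.Dual k V}
    (h : ∀ τ ∈ S, x.comp (τ : V →ₗ[k] V) = x) {σ : V ≃ₗ[k] V}
    (hσ : σ ∈ Subgroup.closure S) : x.comp (σ : V →ₗ[k] V) = x := by
  induction hσ using Subgroup.closure_induction with
  | mem τ hτ => exact h τ hτ
  | one => rfl
  | mul a b _ _ ha hb =>
    ext v
    exact (LinearMap.congr_fun ha (b v)).trans (LinearMap.congr_fun hb v)
  | inv a _ ha =>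
    ext v
    have := LinearMap.congr_fun ha (a⁻¹ v)
    rw [LinearMap.comp_apply] at this
    refine this.symm.trans (congrArg x ?_)
    exact LinearEquiv.congr_fun (mul_inv_cancel a) v

/-- If `G < GL(V)` is a finite abelian group generated by transvections, then
every linear form defining the fixed hyperplane of a transvection in `G` is `G`-invariant
(for the contragradient action, i.e. `x ∘ σ = x` for all `σ ∈ G`); consequently the
annihilator `(V^G)^⊥ ⊆ V*` of the common fixed space `V^G = ⨅ σ ∈ G, V^σ` is spanned by
`G`-invariant linear forms. -/
theorem statement1 [FiniteDimensional k V]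
    (G : Subgroup (V ≃ₗ[k] V)) [Finite ↥G]
    (habelian : ∀ a ∈ G, ∀ b ∈ G, a * b = b * a)
    (hgen : Subgroup.closure {τ | τ ∈ G ∧ IsTransvection τ} = G) :
    (∀ τ ∈ G, IsTransvection τ → ∀ x : Module.Dual k V, LinearMap.ker x = lfix τ →
        ∀ σ ∈ G, x.comp (σ : V →ₗ[k] V) = x) ∧
    Submodule.span k {x : Module.Dual k V |
        (∀ σ ∈ G, x.comp (σ : V →ₗ[k] V) = x) ∧
        x ∈ Submodule.dualAnnihilator (⨅ σ ∈ G, lfix σ)} =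
      Submodule.dualAnnihilator (⨅ σ ∈ G, lfix σ) := by
  have hinv : ∀ τ ∈ G, IsTransvection τ → ∀ x : Module.Dual k V, LinearMap.ker x = lfix τ →
      ∀ σ ∈ G, x.comp (σ : V →ₗ[k] V) = x := by
    intro τ hτG hτ x hx σ hσ
    rw [← hgen] at hσ
    refine comp_eq_of_mem_closure (fun ρ hρ => ?_) hσ
    ext v
    have hmem := hρ.2.1.lmove_le_lfix_of_commute hτ.2 (habelian ρ hρ.1 τ hτG)
      (sub_mem_lmove ρ v)
    rw [← hx, LinearMap.mem_ker, map_sub, sub_eq_zero] at hmem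
    exact hmem
  refine ⟨hinv, le_antisymm (Submodule.span_le.2 fun x hx => hx.2) ?_⟩
  rw [← Subspace.dualCoannihilator_dualAnnihilator_eq (W := Submodule.span k _)]
  refine Submodule.dualAnnihilator_anti fun v hv => ?_
  rw [Submodule.mem_dualCoannihilator] at hv
  simp only [Submodule.mem_iInf]
  intro σ hσ
  rw [← hgen] at hσ
  refine mem_lfix_of_mem_closure (fun τ hτ => ?_) hσ
  obtain ⟨x, hx⟩ := hτ.2.1.exists_ker_eq_lfix
  rw [← hx, LinearMap.mem_ker]
  refine hv x (Submodule.subset_span ⟨hinv τ hτ.1 hτ.2 x hx, ?_⟩)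
  rw [Submodule.mem_dualAnnihilator]
  intro w hw
  rw [← LinearMap.mem_ker, hx]
  exact (Submodule.mem_iInf _).1 ((Submodule.mem_iInf _).1 hw τ) hτ.1
end

section
/- Let G < GL(V) be a finite abelian group generated by pseudo-reflections. Let T be the subgroup generated by the transvections of G and D the subgroup generated by the diagonalizable pseudo-reflections (homologies) of G. Then D is non-modular (|D| is invertible in k), T is a p-group (where p = char k > 0, or trivial if char k = 0), T ∩ D = {1}, and G = T × D. -/
open Module

variable {k V : Type*} [Field k] [AddCommGroup V] [Module k V]

/-- A pseudo-reflection acts on the line it moves by a scalar. -/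
theorem IsPseudoReflection.exists_apply_eq_smul {σ : V ≃ₗ[k] V} (h : IsPseudoReflection σ) :
    ∃ μ : k, ∀ u ∈ lmove σ, σ u = μ • u := by
  obtain ⟨v, -, hv⟩ := finrank_eq_one_iff'.mp h
  have hmem : σ v ∈ lmove σ := by
    have h1 : σ (v : V) - v ∈ lmove σ := ⟨v, by simp⟩
    simpa using add_mem h1 v.2
  obtain ⟨μ, hμ⟩ := hv ⟨_, hmem⟩
  refine ⟨μ, fun u hu => ?_⟩
  obtain ⟨c, hc⟩ := hv ⟨u, hu⟩
  have hc' : c • (v : V) = u := congrArg Subtype.val hc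
  have hμ' : μ • (v : V) = σ v := congrArg Subtype.val hμ
  rw [← hc', map_smul, ← hμ', smul_comm]

theorem IsPseudoReflection.exists_apply_ne {σ : V ≃ₗ[k] V} (h : IsPseudoReflection σ) :
    ∃ w, σ w - w ≠ 0 := by
  obtain ⟨v, hv, -⟩ := finrank_eq_one_iff'.mp h
  obtain ⟨w, hw⟩ := v.2
  refine ⟨w, fun h0 => hv (Subtype.ext ?_)⟩
  rw [← hw]
  simpa using h0

/-- Powers of an automorphism acting on its moved space by the scalar `μ`. -/
theorem pow_apply_of_apply_eq_smul {σ : V ≃ₗ[k] V} {μ : k}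
    (hμ : ∀ u ∈ lmove σ, σ u = μ • u) (n : ℕ) (w : V) :
    (σ ^ n) w = w + (∑ i ∈ Finset.range n, μ ^ i) • (σ w - w) := by
  induction n with
  | zero => simp
  | succ n ih =>
    have h1 : σ (σ w - w) = μ • (σ w - w) := hμ _ ⟨w, by simp⟩
    rw [pow_succ', LinearEquiv.mul_apply, ih, map_add, map_smul, h1, geom_sum_succ, add_smul,
      one_smul, smul_smul, mul_comm]
    abel

/-- A transvection is killed by a power exactly when the exponent vanishes in `k`. -/
theorem IsTransvection.pow_eq_one_iff {τ : V ≃ₗ[k] V} (h : IsTransvection τ) (n : ℕ) :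
    τ ^ n = 1 ↔ (n : k) = 0 := by
  have h1 : ∀ u ∈ lmove τ, τ u = (1 : k) • u := fun u hu => by
    have := h.2 hu
    rw [lfix, LinearMap.mem_ker] at this
    simpa [sub_eq_zero] using this
  have key := pow_apply_of_apply_eq_smul h1 n
  simp only [one_pow, Finset.sum_const, Finset.card_range, nsmul_eq_mul, mul_one] at key
  constructor
  · intro hn
    obtain ⟨w, hw⟩ := h.1.exists_apply_ne
    have := key w
    rw [hn, LinearEquiv.coe_one, id, left_eq_add] at this
    exact (smul_eq_zero.mp this).resolve_right hw
  · intro hn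
    ext w
    rw [key, hn, zero_smul, add_zero]
    rfl

/-- A homology of finite order is killed by an exponent that is invertible in `k`. -/
theorem IsHomology.exists_pow_eq_one {σ : V ≃ₗ[k] V} (h : IsHomology σ)
    (hfin : IsOfFinOrder σ) : ∃ m : ℕ, (m : k) ≠ 0 ∧ σ ^ m = 1 := by
  obtain ⟨μ, hμ⟩ := h.1.exists_apply_eq_smul
  have key := pow_apply_of_apply_eq_smul hμ
  have hμ1 : μ ≠ 1 := by
    rintro rfl
    refine h.2 fun u hu => ?_
    rw [lfix, LinearMap.mem_ker]
    simp [hμ u hu]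
  obtain ⟨w, hw⟩ := h.1.exists_apply_ne
  obtain ⟨n, hn, hσn⟩ := isOfFinOrder_iff_pow_eq_one.mp hfin
  have hsum : ∑ i ∈ Finset.range n, μ ^ i = 0 := by
    have := key n w
    rw [hσn, LinearEquiv.coe_one, id, left_eq_add] at this
    exact (smul_eq_zero.mp this).resolve_right hw
  have hμn : μ ^ n = 1 := by
    rw [← sub_eq_zero, ← mul_geom_sum, hsum, mul_zero]
  have hpos : 0 < orderOf μ := orderOf_pos_iff.mpr (isOfFinOrder_iff_pow_eq_one.mpr ⟨n, hn, hμn⟩)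
  have : NeZero (orderOf μ) := ⟨hpos.ne'⟩
  refine ⟨orderOf μ, (IsPrimitiveRoot.orderOf μ).neZero'.out, ?_⟩
  have hsum' : ∑ i ∈ Finset.range (orderOf μ), μ ^ i = 0 := by
    have := mul_geom_sum μ (orderOf μ)
    rw [pow_orderOf_eq_one, sub_self] at this
    exact (mul_eq_zero.mp this).resolve_left (sub_ne_zero.mpr hμ1)
  ext w
  rw [key, hsum', zero_smul, add_zero]
  rfl

/-- In a commutative subgroup, a property of exponents that is stable under products and holds at
`1` passes from generators to the subgroup they generate. -/
theorem exists_pow_eq_one_of_mem_closure {A : Type*} [Group A] {G : Subgroup A}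
    (hcomm : ∀ a ∈ G, ∀ b ∈ G, a * b = b * a) {S : Set A} (hS : S ⊆ G) {P : ℕ → Prop}
    (hone : P 1) (hmul : ∀ m n, P m → P n → P (m * n))
    (hgen : ∀ s ∈ S, ∃ m, P m ∧ s ^ m = 1) {x : A} (hx : x ∈ Subgroup.closure S) :
    ∃ m, P m ∧ x ^ m = 1 := by
  have hle : Subgroup.closure S ≤ G := (Subgroup.closure_le G).mpr hS
  induction hx using Subgroup.closure_induction with
  | mem s hs => exact hgen s hs
  | one => exact ⟨1, hone, one_pow 1⟩
  | mul x y hx hy ihx ihy =>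
    obtain ⟨m, hm, hxm⟩ := ihx
    obtain ⟨n, hn, hyn⟩ := ihy
    refine ⟨m * n, hmul m n hm hn, ?_⟩
    have hc : Commute x y := hcomm x (hle hx) y (hle hy)
    rw [hc.mul_pow, pow_mul, hxm, one_pow, pow_mul', hyn, one_pow, one_mul]
  | inv x _ ih =>
    obtain ⟨m, hm, hxm⟩ := ih
    exact ⟨m, hm, by rw [inv_pow, hxm, inv_one]⟩

/-- Let `G < GL(V)` be a finite abelian group generated by
pseudo-reflections, `T` the subgroup generated by the transvections of `G` and `D` the
subgroup generated by the homologies (diagonalizable pseudo-reflections) of `G`. Then `D` is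
non-modular (`|D|` is invertible in `k`), `T` is a `p`-group when `char k = p > 0` and
trivial when `char k = 0`, `T ∩ D = {1}` and `G = T × D` (an internal direct product:
`T ⊓ D = ⊥` and `T ⊔ D = G`; the factors commute since `G` is abelian). -/
theorem statement4 [FiniteDimensional k V]
    (G : Subgroup (V ≃ₗ[k] V)) [Finite ↥G]
    (habelian : ∀ a ∈ G, ∀ b ∈ G, a * b = b * a)
    (hgen : Subgroup.closure {σ | σ ∈ G ∧ IsPseudoReflection σ} = G)
    (T D : Subgroup (V ≃ₗ[k] V))
    (hT : T = Subgroup.closure {τ | τ ∈ G ∧ IsTransvection τ})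
    (hD : D = Subgroup.closure {σ | σ ∈ G ∧ IsHomology σ}) :
    (Nat.card ↥D : k) ≠ 0 ∧
    (∀ p : ℕ, p.Prime → ringChar k = p → IsPGroup p ↥T) ∧
    (ringChar k = 0 → T = ⊥) ∧
    T ⊓ D = ⊥ ∧ T ⊔ D = G := by
  have hfin : ∀ σ ∈ G, IsOfFinOrder σ := fun σ hσ =>
    G.subtype.isOfFinOrder (isOfFinOrder_of_finite (⟨σ, hσ⟩ : G))
  have hTG : {τ | τ ∈ G ∧ IsTransvection τ} ⊆ (G : Set (V ≃ₗ[k] V)) := fun _ h => h.1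
  have hDG : {σ | σ ∈ G ∧ IsHomology σ} ⊆ (G : Set (V ≃ₗ[k] V)) := fun _ h => h.1
  have hDexp : ∀ x ∈ D, ∃ m : ℕ, (m : k) ≠ 0 ∧ x ^ m = 1 := by
    intro x hx
    rw [hD] at hx
    refine exists_pow_eq_one_of_mem_closure habelian hDG (P := fun m => (m : k) ≠ 0)
      (by simp) (fun m n hm hn => ?_) (fun s hs => hs.2.exists_pow_eq_one (hfin s hs.1)) hx
    rw [Nat.cast_mul]
    exact mul_ne_zero hm hn
  have hTexp : ∀ p : ℕ, ringChar k = p → ∀ x ∈ T, ∃ n : ℕ, x ^ p ^ n = 1 := by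
    intro p hp x hx
    rw [hT] at hx
    obtain ⟨_, ⟨n, rfl⟩, h⟩ := exists_pow_eq_one_of_mem_closure habelian hTG
      (P := fun m => ∃ n : ℕ, p ^ n = m) ⟨0, pow_zero p⟩
      (by rintro _ _ ⟨a, rfl⟩ ⟨b, rfl⟩; exact ⟨a + b, pow_add p a b⟩)
      (fun s hs => ⟨p, ⟨1, pow_one p⟩, (hs.2.pow_eq_one_iff p).mpr (by simp [← hp])⟩) hx
    exact ⟨n, h⟩
  have hT0 : ringChar k = 0 → T = ⊥ := by
    intro h0
    rw [hT, Subgroup.closure_eq_bot_iff]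
    rintro τ ⟨hτG, hτ⟩
    have h1 := (hτ.pow_eq_one_iff (orderOf τ)).mp (pow_orderOf_eq_one τ)
    have h2 : orderOf τ = 0 := by
      rwa [ringChar.spec, h0, zero_dvd_iff] at h1
    exact absurd (hfin τ hτG) (orderOf_eq_zero_iff.mp h2)
  have hDle : D ≤ G := hD ▸ (Subgroup.closure_le G).mpr hDG
  have : Finite D := Finite.of_injective _ (Subgroup.inclusion_injective hDle)
  refine ⟨fun hcard => ?_, fun p _ hchar x => ?_, hT0, ?_, ?_⟩
  · rcases CharP.char_is_prime_or_zero k (ringChar k) with hp | h0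
    · have := Fact.mk hp
      obtain ⟨x, hx⟩ := exists_prime_orderOf_dvd_card' (G := D) (ringChar k)
        ((ringChar.spec k _).mp hcard)
      obtain ⟨m, hm, hxm⟩ := hDexp x x.2
      exact hm ((ringChar.spec k m).mpr (hx ▸ orderOf_dvd_of_pow_eq_one (Subtype.ext hxm)))
    · rw [ringChar.spec, h0, zero_dvd_iff] at hcard
      exact Nat.card_pos.ne' hcard
  · obtain ⟨n, hn⟩ := hTexp p hchar x x.2
    exact ⟨n, Subtype.ext hn⟩
  · rcases CharP.char_is_prime_or_zero k (ringChar k) with hp | h0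
    · refine (Subgroup.eq_bot_iff_forall _).mpr fun x hx => ?_
      obtain ⟨n, hn⟩ := hTexp _ rfl x hx.1
      obtain ⟨m, hm, hxm⟩ := hDexp x hx.2
      have hcop : Nat.Coprime (ringChar k ^ n) m :=
        Nat.Coprime.pow_left n ((Nat.Prime.coprime_iff_not_dvd hp).mpr
          fun hd => hm ((ringChar.spec k m).mpr hd))
      exact orderOf_eq_one_iff.mp (Nat.eq_one_of_dvd_coprimes hcop
        (orderOf_dvd_of_pow_eq_one hn) (orderOf_dvd_of_pow_eq_one hxm))
    · rw [hT0 h0, bot_inf_eq]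
  · rw [hT, hD, ← Subgroup.closure_union, ← hgen]
    congr 1
    ext σ
    rw [hgen]
    simp only [IsTransvection, IsHomology, Set.mem_union, Set.mem_ofPred_eq]
    tauto
end
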